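/- arXiv:1108.2363 — 2 statements merged into one kernel-verified Lean document; each statement's English description precedes it below -/
import Mathlib

section
/- Let σ : ℝ → ℝ⁵ be a smooth curve with ⟨σ(s),σ(s)⟩ = 1 and ⟨σ'(s),σ'(s)⟩ = 1 for all s (a space-like curve in de Sitter space Λ⁴ parametrized by arc length), and suppose σ is L-periodic for some L > 0 (so σ is a closed curve of length L). Assume that the geodesic curvature vector k_g(s) = σ(s) + σ''(s) satisfies k_g(s) ≠ 0 and ⟨k_g(s),k_g(s)⟩ ≤ 0 for every s (σ is an almost regular canal). Then L ≥ 2π. -/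
/-- The Lorentz bilinear form of signature (4,1) on ℝ⁵. -/
noncomputable def lorentz (x y : Fin 5 → ℝ) : ℝ :=
  x 0 * y 0 + x 1 * y 1 + x 2 * y 2 + x 3 * y 3 - x 4 * y 4

theorem HasDerivAt.lorentz {a b : ℝ → Fin 5 → ℝ} {a' b' : Fin 5 → ℝ} {t : ℝ}
    (ha : HasDerivAt a a' t) (hb : HasDerivAt b b' t) :
    HasDerivAt (fun s => lorentz (a s) (b s)) (lorentz a' (b t) + lorentz (a t) b') t := by
  rw [hasDerivAt_pi] at ha hb
  unfold _root_.lorentz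
  refine (((((ha 0).mul (hb 0)).add ((ha 1).mul (hb 1))).add ((ha 2).mul (hb 2))).add
    ((ha 3).mul (hb 3)) |>.sub ((ha 4).mul (hb 4))).congr_deriv ?_
  ring

theorem Continuous.lorentz {X : Type*} [TopologicalSpace X] {a b : X → Fin 5 → ℝ}
    (ha : Continuous a) (hb : Continuous b) : Continuous fun s => lorentz (a s) (b s) := by
  unfold _root_.lorentz
  fun_prop

theorem lorentz_comm (x y : Fin 5 → ℝ) : lorentz x y = lorentz y x := by
  unfold lorentz
  ring

theorem lorentz_add_left (x y z : Fin 5 → ℝ) :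
    lorentz (x + y) z = lorentz x z + lorentz y z := by
  simp only [lorentz, Pi.add_apply]
  ring

theorem lorentz_add_right (x y z : Fin 5 → ℝ) :
    lorentz x (y + z) = lorentz x y + lorentz x z := by
  simp only [lorentz, Pi.add_apply]
  ring

@[simp]
theorem lorentz_zero_right (x : Fin 5 → ℝ) : lorentz x 0 = 0 := by
  simp [lorentz]

/-- A nonzero causal vector has a nonzero time component. -/
theorem time_ne_zero_of_lorentz_self_nonpos {x : Fin 5 → ℝ} (hx : x ≠ 0)
    (hxx : lorentz x x ≤ 0) : x 4 ≠ 0 := by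
  intro h4
  apply hx
  unfold lorentz at hxx
  rw [h4] at hxx
  have h0 := mul_self_nonneg (x 0)
  have h1 := mul_self_nonneg (x 1)
  have h2 := mul_self_nonneg (x 2)
  have h3 := mul_self_nonneg (x 3)
  have e0 : x 0 = 0 := mul_self_eq_zero.mp (by linarith)
  have e1 : x 1 = 0 := mul_self_eq_zero.mp (by linarith)
  have e2 : x 2 = 0 := mul_self_eq_zero.mp (by linarith)
  have e3 : x 3 = 0 := mul_self_eq_zero.mp (by linarith)
  ext i
  fin_cases i <;> assumption

/-- Causal vectors in the same half-cone have nonpositive Lorentz product. -/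
theorem lorentz_nonpos_of_causal {x y : Fin 5 → ℝ} (hx : lorentz x x ≤ 0)
    (hy : lorentz y y ≤ 0) (hxy : 0 ≤ x 4 * y 4) : lorentz x y ≤ 0 := by
  unfold lorentz at *
  have hcs := Finset.sum_mul_sq_le_sq_mul_sq Finset.univ
    ![x 0, x 1, x 2, x 3] ![y 0, y 1, y 2, y 3]
  simp only [Fin.sum_univ_four, Matrix.cons_val] at hcs
  have hle : (x 0 ^ 2 + x 1 ^ 2 + x 2 ^ 2 + x 3 ^ 2) * (y 0 ^ 2 + y 1 ^ 2 + y 2 ^ 2 + y 3 ^ 2)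
      ≤ x 4 ^ 2 * y 4 ^ 2 := by
    apply mul_le_mul <;> first | positivity | linarith
  rw [← mul_pow] at hle
  linarith [(le_abs_self _).trans (abs_le_of_sq_le_sq (hcs.trans hle) hxy)]

/-- A continuous field of nonzero causal vectors stays in one half of the light cone. -/
theorem lorentz_nonpos_of_continuous_causal {k : ℝ → Fin 5 → ℝ} (hk : Continuous k)
    (hne : ∀ s, k s ≠ 0) (hcausal : ∀ s, lorentz (k s) (k s) ≤ 0) (s t : ℝ) :
    lorentz (k s) (k t) ≤ 0 := by
  refine lorentz_nonpos_of_causal (hcausal s) (hcausal t) ?_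
  by_contra! hneg
  have hc : Continuous fun r => k r 4 * k t 4 := by fun_prop
  obtain ⟨r, hr⟩ := mem_range_of_exists_le_of_exists_ge hc ⟨s, hneg.le⟩
    ⟨t, mul_self_nonneg (k t 4)⟩
  exact (mul_ne_zero (time_ne_zero_of_lorentz_self_nonpos (hne r) (hcausal r))
    (time_ne_zero_of_lorentz_self_nonpos (hne t) (hcausal t))) hr

theorem hasDerivAt_mul_sin_kernel {g g' : ℝ → ℝ} {g'' c y : ℝ} (hg : HasDerivAt g (g' y) y)
    (hg' : HasDerivAt g' g'' y) :
    HasDerivAt (fun y => (y - c) * Real.sin (y - c) * g' y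
      - (Real.sin (y - c) + (y - c) * Real.cos (y - c)) * g y)
      ((y - c) * Real.sin (y - c) * (g y + g'') - 2 * (Real.cos (y - c) * g y)) y := by
  have hx : HasDerivAt (fun y => y - c) 1 y := (hasDerivAt_id y).sub_const c
  refine (((hx.mul hx.sin).mul hg').sub ((hx.sin.add (hx.mul hx.cos)).mul hg)).congr_deriv ?_
  simp only [Pi.mul_apply, Pi.add_apply]
  ring

theorem hasDerivAt_cos_kernel {h h' : ℝ → ℝ} {h'' c y : ℝ} (hh : HasDerivAt h (h' y) y)
    (hh' : HasDerivAt h' h'' y) :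
    HasDerivAt (fun y => Real.cos (y - c) * h' y + Real.sin (y - c) * h y)
      (Real.cos (y - c) * (h y + h'')) y := by
  have hx : HasDerivAt (fun y => y - c) 1 y := (hasDerivAt_id y).sub_const c
  refine ((hx.cos.mul hh').add (hx.sin.mul hh)).congr_deriv ?_
  ring

theorem Real.mul_sin_nonneg_of_abs_le_pi {x : ℝ} (hx : |x| ≤ Real.pi) : 0 ≤ x * Real.sin x := by
  obtain ⟨h1, h2⟩ := abs_le.mp hx
  rcases le_total 0 x with h | h
  · exact mul_nonneg h (Real.sin_nonneg_of_nonneg_of_le_pi h h2)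
  · exact mul_nonneg_of_nonpos_of_nonpos h (Real.sin_nonpos_of_nonpos_of_neg_pi_le h h1)

section Curve

variable {σ σ' σ'' : ℝ → Fin 5 → ℝ}

theorem integral_lorentz_shift_sub_eq_zero {L : ℝ}
    (h1 : ∀ s, HasDerivAt σ (σ' s) s) (h2 : ∀ s, HasDerivAt σ' (σ'' s) s)
    (h3 : Continuous σ'') (hp : ∀ s, σ (s + L) = σ s) (hp' : ∀ s, σ' (s + L) = σ' s) (y : ℝ) :
    ∫ u in (0 : ℝ)..L, (lorentz (σ (u + y)) (σ u + σ'' u)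
      - lorentz (σ (u + y) + σ'' (u + y)) (σ u)) = 0 := by
  have c0 : Continuous σ := continuous_iff_continuousAt.2 fun s => (h1 s).continuousAt
  have hd : ∀ u, HasDerivAt
      (fun u => lorentz (σ (u + y)) (σ' u) - lorentz (σ' (u + y)) (σ u))
      (lorentz (σ (u + y)) (σ u + σ'' u) - lorentz (σ (u + y) + σ'' (u + y)) (σ u)) u := by
    intro u
    refine ((((h1 (u + y)).comp_add_const u y).lorentz (h2 u)).sub
      (((h2 (u + y)).comp_add_const u y).lorentz (h1 u))).congr_deriv ?_
    rw [lorentz_add_left, lorentz_add_right]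
    ring
  rw [intervalIntegral.integral_eq_sub_of_hasDerivAt (fun u _ => hd u)]
  · have e1 : L + y = y + L := add_comm _ _
    have e2 := hp 0
    have e3 := hp' 0
    rw [zero_add] at e2 e3
    rw [e1, hp, hp', e2, e3]
    simp
  · refine Continuous.intervalIntegrable (Continuous.sub ?_ ?_) _ _ <;>
      exact Continuous.lorentz (by fun_prop) (by fun_prop)

theorem integral_cos_mul_lorentz_shift {L : ℝ}
    (h1 : ∀ s, HasDerivAt σ (σ' s) s) (h2 : ∀ s, HasDerivAt σ' (σ'' s) s)
    (h3 : Continuous σ'') (hp : ∀ s, σ (s + L) = σ s) (hp' : ∀ s, σ' (s + L) = σ' s) (u : ℝ)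
    (n : Fin 5 → ℝ) :
    ∫ y in (0 : ℝ)..L, Real.cos (y - L / 2) * lorentz (σ (u + y) + σ'' (u + y)) n
      = 2 * Real.sin (L / 2) * lorentz (σ u) n := by
  have c0 : Continuous σ := continuous_iff_continuousAt.2 fun s => (h1 s).continuousAt
  have d1 : ∀ y, HasDerivAt (fun y => lorentz (σ (u + y)) n) (lorentz (σ' (u + y)) n) y := by
    intro y
    simpa using ((h1 (u + y)).comp_const_add u y).lorentz (hasDerivAt_const y n)
  have d2 : ∀ y, HasDerivAt (fun y => lorentz (σ' (u + y)) n) (lorentz (σ'' (u + y)) n) y := by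
    intro y
    simpa using ((h2 (u + y)).comp_const_add u y).lorentz (hasDerivAt_const y n)
  simp only [lorentz_add_left]
  rw [intervalIntegral.integral_eq_sub_of_hasDerivAt
    (fun y _ => hasDerivAt_cos_kernel (c := L / 2) (d1 y) (d2 y))]
  · rw [hp, hp', add_zero, zero_sub, Real.cos_neg, Real.sin_neg, sub_half]
    ring
  · refine Continuous.intervalIntegrable (Continuous.mul (by fun_prop) (Continuous.add ?_ ?_)) _ _
      <;> exact Continuous.lorentz (by fun_prop) (by fun_prop)

/-- Since `n` is orthogonal to `σ u` and `σ' u`, integrating by parts leaves no boundary terms. -/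
theorem integral_cos_mul_lorentz_shift_nonpos {L : ℝ} (hL : 0 < L) (hLpi : L ≤ 2 * Real.pi)
    (h1 : ∀ s, HasDerivAt σ (σ' s) s) (h2 : ∀ s, HasDerivAt σ' (σ'' s) s)
    (h3 : Continuous σ'') (hp : ∀ s, σ (s + L) = σ s) (hp' : ∀ s, σ' (s + L) = σ' s) (u : ℝ)
    (n : Fin 5 → ℝ) (hn : lorentz (σ u) n = 0) (hn' : lorentz (σ' u) n = 0)
    (hneg : ∀ s, lorentz (σ s + σ'' s) n ≤ 0) :
    ∫ y in (0 : ℝ)..L, Real.cos (y - L / 2) * lorentz (σ (u + y)) n ≤ 0 := by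
  have c0 : Continuous σ := continuous_iff_continuousAt.2 fun s => (h1 s).continuousAt
  have d1 : ∀ y, HasDerivAt (fun y => lorentz (σ (u + y)) n) (lorentz (σ' (u + y)) n) y := by
    intro y
    simpa using ((h1 (u + y)).comp_const_add u y).lorentz (hasDerivAt_const y n)
  have d2 : ∀ y, HasDerivAt (fun y => lorentz (σ' (u + y)) n) (lorentz (σ'' (u + y)) n) y := by
    intro y
    simpa using ((h2 (u + y)).comp_const_add u y).lorentz (hasDerivAt_const y n)
  have cA : Continuous fun y => lorentz (σ (u + y)) n :=
    Continuous.lorentz (by fun_prop) (by fun_prop)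
  have cB : Continuous fun y => lorentz (σ'' (u + y)) n :=
    Continuous.lorentz (by fun_prop) (by fun_prop)
  have hI1 : IntervalIntegrable (fun y => (y - L / 2) * Real.sin (y - L / 2)
      * (lorentz (σ (u + y)) n + lorentz (σ'' (u + y)) n)) MeasureTheory.volume 0 L :=
    Continuous.intervalIntegrable (by fun_prop) _ _
  have hI2 : IntervalIntegrable (fun y => 2 * (Real.cos (y - L / 2) * lorentz (σ (u + y)) n))
      MeasureTheory.volume 0 L := Continuous.intervalIntegrable (by fun_prop) _ _
  have key := intervalIntegral.integral_eq_sub_of_hasDerivAt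
    (fun y _ => hasDerivAt_mul_sin_kernel (c := L / 2) (d1 y) (d2 y)) (hI1.sub hI2)
  rw [intervalIntegral.integral_sub hI1 hI2, intervalIntegral.integral_const_mul, hp, hp',
    add_zero, hn, hn'] at key
  have hle : ∫ y in (0 : ℝ)..L, (y - L / 2) * Real.sin (y - L / 2)
      * (lorentz (σ (u + y)) n + lorentz (σ'' (u + y)) n) ≤ 0 := by
    rw [← neg_nonneg, ← intervalIntegral.integral_neg]
    refine intervalIntegral.integral_nonneg hL.le fun y hy => ?_
    rw [← lorentz_add_left, neg_nonneg]
    refine mul_nonpos_of_nonneg_of_nonpos (Real.mul_sin_nonneg_of_abs_le_pi ?_) (hneg _)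
    rw [abs_le]
    constructor <;> linarith [hy.1, hy.2]
  linarith

end Curve

/-- A closed almost-regular canal (space-like curve in de Sitter space Λ⁴,
parametrized by arc length, with nowhere vanishing, nowhere space-like
geodesic curvature vector) has length at least `2π`. -/
theorem length_of_closed_almost_regular_canal
    (σ : ℝ → Fin 5 → ℝ) (L : ℝ) (hL : 0 < L)
    (hσ : ContDiff ℝ (⊤ : ℕ∞) σ)
    (hper : ∀ s, σ (s + L) = σ s)
    (hunit : ∀ s, lorentz (σ s) (σ s) = 1)
    (harc : ∀ s, lorentz (deriv σ s) (deriv σ s) = 1)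
    (hkg_ne : ∀ s, σ s + deriv (deriv σ) s ≠ 0)
    (hkg : ∀ s, lorentz (σ s + deriv (deriv σ) s) (σ s + deriv (deriv σ) s) ≤ 0) :
    2 * Real.pi ≤ L := by
  by_contra! hlt
  have hσ' : ContDiff ℝ (⊤ : ℕ∞) (deriv σ) := (contDiff_infty_iff_deriv.mp hσ).2
  have c0 : Continuous σ := hσ.continuous
  have c2 : Continuous (deriv (deriv σ)) := (contDiff_infty_iff_deriv.mp hσ').2.continuous
  have h1 : ∀ s, HasDerivAt σ (deriv σ s) s := fun s =>
    ((contDiff_infty_iff_deriv.mp hσ).1 s).hasDerivAt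
  have h2 : ∀ s, HasDerivAt (deriv σ) (deriv (deriv σ) s) s := fun s =>
    ((contDiff_infty_iff_deriv.mp hσ').1 s).hasDerivAt
  have hper' : ∀ s, deriv σ (s + L) = deriv σ s := by
    intro s
    rw [← deriv_comp_add_const, show (fun x => σ (x + L)) = σ from funext hper]
  have o1 : ∀ s, lorentz (σ s) (deriv σ s) = 0 := by
    intro s
    have hd := (h1 s).lorentz (h1 s)
    simp only [hunit] at hd
    have := hd.unique (hasDerivAt_const s 1)
    rw [lorentz_comm] at this
    linarith
  have o2 : ∀ s, lorentz (σ s) (deriv (deriv σ) s) = -1 := by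
    intro s
    have hd := (h1 s).lorentz (h2 s)
    simp only [o1] at hd
    have := hd.unique (hasDerivAt_const s 0)
    linarith [harc s]
  have o3 : ∀ s, lorentz (deriv σ s) (deriv (deriv σ) s) = 0 := by
    intro s
    have hd := (h2 s).lorentz (h2 s)
    simp only [harc] at hd
    have := hd.unique (hasDerivAt_const s 1)
    rw [lorentz_comm] at this
    linarith
  have hneg := lorentz_nonpos_of_continuous_causal (k := fun s => σ s + deriv (deriv σ) s)
    (by fun_prop) hkg_ne hkg
  set F : ℝ → ℝ → ℝ := fun u y => Real.cos (y - L / 2)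
    * (lorentz (σ (u + y)) (σ u + deriv (deriv σ) u)
      - lorentz (σ (u + y) + deriv (deriv σ) (u + y)) (σ u)) with hF
  have cF : Continuous (Function.uncurry F) := by
    refine Continuous.mul (by fun_prop) (Continuous.sub ?_ ?_) <;>
      exact Continuous.lorentz (by fun_prop) (by fun_prop)
  have hswap : ∫ u in (0 : ℝ)..L, ∫ y in (0 : ℝ)..L, F u y
      = ∫ y in (0 : ℝ)..L, ∫ u in (0 : ℝ)..L, F u y := by
    refine MeasureTheory.intervalIntegral_intervalIntegral_swap ?_
    exact (cF.continuousOn.integrableOn_compact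
      (isCompact_uIcc.prod isCompact_uIcc)).mono_set
      (Set.prod_mono Set.uIoc_subset_uIcc Set.uIoc_subset_uIcc)
  have hzero : ∀ y, ∫ u in (0 : ℝ)..L, F u y = 0 := by
    intro y
    rw [hF, intervalIntegral.integral_const_mul,
      integral_lorentz_shift_sub_eq_zero h1 h2 c2 hper hper', mul_zero]
  have hinner : ∀ u, ∫ y in (0 : ℝ)..L, F u y ≤ -(2 * Real.sin (L / 2)) := by
    intro u
    have hle := integral_cos_mul_lorentz_shift_nonpos hL hlt.le h1 h2 c2 hper hper' u
      (σ u + deriv (deriv σ) u) (by rw [lorentz_add_right, hunit, o2]; ring)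
      (by rw [lorentz_add_right, o3, lorentz_comm, o1, add_zero]) (fun s => hneg s u)
    have heq := integral_cos_mul_lorentz_shift h1 h2 c2 hper hper' u (σ u)
    have cA : Continuous fun y => lorentz (σ (u + y)) (σ u + deriv (deriv σ) u) :=
      Continuous.lorentz (by fun_prop) (by fun_prop)
    have cB : Continuous fun y => lorentz (σ (u + y) + deriv (deriv σ) (u + y)) (σ u) :=
      Continuous.lorentz (by fun_prop) (by fun_prop)
    simp only [hF, mul_sub]
    rw [intervalIntegral.integral_sub (Continuous.intervalIntegrable (by fun_prop) _ _)
      (Continuous.intervalIntegrable (by fun_prop) _ _), heq, hunit]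
    linarith
  have hsin : 0 < Real.sin (L / 2) := Real.sin_pos_of_pos_of_lt_pi (by linarith) (by linarith)
  have hmono : ∫ u in (0 : ℝ)..L, ∫ y in (0 : ℝ)..L, F u y
      ≤ ∫ _ in (0 : ℝ)..L, -(2 * Real.sin (L / 2)) :=
    intervalIntegral.integral_mono_on hL.le
      (Continuous.intervalIntegrable
        (intervalIntegral.continuous_parametric_intervalIntegral_of_continuous' cF 0 L) _ _)
      (Continuous.intervalIntegrable continuous_const _ _) fun u _ => hinner u
  rw [hswap] at hmono
  simp only [hzero, intervalIntegral.integral_const, smul_eq_mul, mul_zero, sub_zero] at hmono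
  nlinarith [mul_pos hL hsin]
end

section
/- Let θ, r : [0,1] → ℝ be smooth with r(t) ∈ (0,π) for all t, and define σ : [0,1] → ℝ³ by σ(t) = (cos θ(t)/sin r(t), sin θ(t)/sin r(t), cos r(t)/sin r(t)), so that ⟨σ(t),σ(t)⟩ = 1 (σ is the path in Λ² of 0-spheres of S¹ with centers m(t) = (cos θ(t), sin θ(t)) and radii r(t)). Assume: (i) ⟨σ'(t),σ'(t)⟩ > 0 for all t (the path is space-like); (ii) the geodesic curvature vector k_g(t) = σ(t) + (σ''(t) − (⟨σ''(t),σ'(t)⟩/⟨σ'(t),σ'(t)⟩)σ'(t))/⟨σ'(t),σ'(t)⟩ satisfies ⟨k_g(t),k_g(t)⟩ < 0 for all t (the canal is regular); (iii) ∫₀¹ |θ'(t)| dt ≥ 2π (the curve of centers has length at least 2π); (iv) r attains its minimum over [0,1] at both t = 0 and t = 1, and r'(0) = r'(1) = 0. Then the Lorentz length of σ satisfies ∫₀¹ √(⟨σ'(t),σ'(t)⟩) dt > 2π. -/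
/-- The Lorentz bilinear form of signature (2,1) on ℝ³. -/
noncomputable def lorentz3 (x y : Fin 3 → ℝ) : ℝ :=
  x 0 * y 0 + x 1 * y 1 - x 2 * y 2

open Real Set

theorem hasDerivAt_klein_sqrt {C E : ℝ → ℝ} {t d' G : ℝ}
    (hC : HasDerivAt C (E t * d') t) (hE : HasDerivAt E (G - C t * d') t)
    (h : C t ^ 2 + E t ^ 2 < 1) :
    HasDerivAt (fun u => √(1 - C u ^ 2 - E u ^ 2))
      (-(E t * G) / √(1 - C t ^ 2 - E t ^ 2)) t := by
  have hpos : 0 < 1 - C t ^ 2 - E t ^ 2 := by linarith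
  have h1 := (((hC.pow 2).const_sub 1).sub (hE.pow 2)).sqrt hpos.ne'
  refine h1.congr_deriv ?_
  have := (sqrt_pos.2 hpos).ne'
  simp only [Pi.sub_apply, Pi.pow_apply]
  field_simp
  norm_num
  ring

theorem hasDerivAt_normal_arctan {C E : ℝ → ℝ} {t d' G : ℝ}
    (hC : HasDerivAt C (E t * d') t) (hE : HasDerivAt E (G - C t * d') t)
    (h : C t ^ 2 + E t ^ 2 < 1) :
    HasDerivAt (fun u => arctan (C u * E u / (1 + √(1 - C u ^ 2 - E u ^ 2) - C u ^ 2)))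
      (d' - √(1 - C t ^ 2 - E t ^ 2) / (1 - C t ^ 2) * d' +
        G * C t / (√(1 - C t ^ 2 - E t ^ 2) * (1 + √(1 - C t ^ 2 - E t ^ 2)))) t := by
  have hpos : 0 < 1 - C t ^ 2 - E t ^ 2 := by linarith
  have hm := sqrt_pos.2 hpos
  have hm2 := sq_sqrt hpos.le
  have hn : 0 < 1 - C t ^ 2 := by nlinarith [sq_nonneg (E t)]
  have hden : 0 < 1 + √(1 - C t ^ 2 - E t ^ 2) - C t ^ 2 := by linarith
  have h1 := ((hC.mul hE).div (((hasDerivAt_klein_sqrt hC hE h).const_add 1).sub (hC.pow 2))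
    (by simpa using hden.ne')).arctan
  refine h1.congr_deriv ?_
  simp only [Pi.sub_apply, Pi.pow_apply, Pi.mul_apply, Pi.div_apply]
  generalize √(1 - C t ^ 2 - E t ^ 2) = m at *
  generalize C t = c at *
  generalize E t = e at *
  have hsq : 1 + (c * e / (1 + m - c ^ 2)) ^ 2
      = (1 - c ^ 2) * (1 + m) ^ 2 / (1 + m - c ^ 2) ^ 2 := by
    field_simp
    linear_combination (c ^ 2) * hm2
  have h1m : 0 < 1 + m := by linarith
  rw [hsq]
  field_simp
  clear h1 hC hE
  grind

theorem hasDerivAt_triangle_arctan {C E α β : ℝ → ℝ} {m₀ t d' G : ℝ}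
    (hC : HasDerivAt C (E t * d') t) (hE : HasDerivAt E (G - C t * d') t)
    (hα : HasDerivAt α (β t * d') t) (hβ : HasDerivAt β (-(α t) * d') t)
    (h : C t ^ 2 + E t ^ 2 < 1) (hm₀ : 0 < m₀) (hm₀' : m₀ ^ 2 = 1 - α t ^ 2 - β t ^ 2) :
    ∃ W > 0, HasDerivAt (fun u => 2 * arctan ((α u * E u - β u * C u) /
        ((1 + √(1 - C u ^ 2 - E u ^ 2)) * (1 + m₀) - C u * α u - E u * β u)))
      (G * C t / (√(1 - C t ^ 2 - E t ^ 2) * (1 + √(1 - C t ^ 2 - E t ^ 2))) -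
        G * (C t - α t) * W) t := by
  have hpos : 0 < 1 - C t ^ 2 - E t ^ 2 := by linarith
  have hm := sqrt_pos.2 hpos
  have hm2 := sq_sqrt hpos.le
  have hD : 0 < 1 + √(1 - C t ^ 2 - E t ^ 2) * m₀ - C t * α t - E t * β t := by
    nlinarith [mul_pos hm hm₀, sq_nonneg (C t - α t), sq_nonneg (E t - β t), sq_nonneg m₀]
  have hden : 0 < (1 + √(1 - C t ^ 2 - E t ^ 2)) * (1 + m₀) - C t * α t - E t * β t := by
    linarith
  refine ⟨1 / (√(1 - C t ^ 2 - E t ^ 2) *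
    (1 + √(1 - C t ^ 2 - E t ^ 2) * m₀ - C t * α t - E t * β t)), by positivity, ?_⟩
  have h1 := ((((hα.mul hE).sub (hβ.mul hC)).div
    ((((((hasDerivAt_klein_sqrt hC hE h).const_add 1).mul_const (1 + m₀)).sub
      (hC.mul hα)).sub (hE.mul hβ))) (by simpa using hden.ne')).arctan).const_mul 2
  refine h1.congr_deriv ?_
  simp only [Pi.sub_apply, Pi.mul_apply, Pi.div_apply]
  generalize √(1 - C t ^ 2 - E t ^ 2) = m at *
  generalize C t = c at *
  generalize E t = e at *
  generalize α t = a at *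
  generalize β t = b at *
  have h1m : 0 < 1 + m := by linarith
  have h1m₀ : 0 < 1 + m₀ := by linarith
  have hsq : 1 + ((a * e - b * c) / ((1 + m) * (1 + m₀) - c * a - e * b)) ^ 2
      = 2 * (1 + m) * (1 + m₀) * (1 + m * m₀ - c * a - e * b) /
        ((1 + m) * (1 + m₀) - c * a - e * b) ^ 2 := by
    have hne := pow_ne_zero 2 hden.ne'
    rw [div_pow, eq_div_iff hne, add_mul, div_mul_cancel₀ _ hne]
    clear h1 hC hE hα hβ hne
    grind
  rw [hsq]
  field_simp
  clear h1 hC hE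
  grind

/-- Total angle, seen from the point `(a, b)` of the Klein disc, of the tangent at the point of the
disc whose coordinates are `(C, E)` in the frame rotated by `d`. -/
noncomputable def kleinTurning (a b d C E : ℝ) : ℝ :=
  d - arctan (C * E / (1 + √(1 - C ^ 2 - E ^ 2) - C ^ 2)) +
    2 * arctan (((a * cos d + b * sin d) * E - (b * cos d - a * sin d) * C) /
      ((1 + √(1 - C ^ 2 - E ^ 2)) * (1 + √(1 - a ^ 2 - b ^ 2)) - C * (a * cos d + b * sin d) -
        E * (b * cos d - a * sin d)))

theorem hasDerivAt_kleinTurning {a b : ℝ} {d C E : ℝ → ℝ} {t d' G : ℝ} (hd : HasDerivAt d d' t)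
    (hC : HasDerivAt C (E t * d') t) (hE : HasDerivAt E (G - C t * d') t)
    (h : C t ^ 2 + E t ^ 2 < 1) (hab : a ^ 2 + b ^ 2 < 1) :
    ∃ W > 0, HasDerivAt (fun u => kleinTurning a b (d u) (C u) (E u))
      (√(1 - C t ^ 2 - E t ^ 2) / (1 - C t ^ 2) * d' -
        G * (C t - (a * cos (d t) + b * sin (d t))) * W) t := by
  have hα : HasDerivAt (fun u => a * cos (d u) + b * sin (d u))
      ((b * cos (d t) - a * sin (d t)) * d') t :=
    ((hd.cos.const_mul a).add (hd.sin.const_mul b)).congr_deriv (by ring)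
  have hβ : HasDerivAt (fun u => b * cos (d u) - a * sin (d u))
      (-(a * cos (d t) + b * sin (d t)) * d') t :=
    ((hd.cos.const_mul b).sub (hd.sin.const_mul a)).congr_deriv (by ring)
  have hpos : 0 < 1 - a ^ 2 - b ^ 2 := by linarith
  obtain ⟨W, hW, hder⟩ := hasDerivAt_triangle_arctan
    (α := fun u => a * cos (d u) + b * sin (d u)) (β := fun u => b * cos (d u) - a * sin (d u))
    hC hE hα hβ h (sqrt_pos.2 hpos) (by
      rw [sq_sqrt hpos.le]
      linear_combination (a ^ 2 + b ^ 2) * sin_sq_add_cos_sq (d t))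
  exact ⟨W, hW, ((hd.sub (hasDerivAt_normal_arctan hC hE h)).add hder).congr_deriv (by ring)⟩

theorem continuousOn_kleinTurning {a b : ℝ} {d C E : ℝ → ℝ} {s : Set ℝ} (hd : ContinuousOn d s)
    (hC : ContinuousOn C s) (hE : ContinuousOn E s) (h : ∀ t ∈ s, C t ^ 2 + E t ^ 2 < 1)
    (hab : a ^ 2 + b ^ 2 < 1) :
    ContinuousOn (fun u => kleinTurning a b (d u) (C u) (E u)) s := by
  unfold kleinTurning
  refine (hd.sub (continuous_arctan.comp_continuousOn
    ((hC.mul hE).div (by fun_prop) fun t ht => ?_))).add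
      (continuousOn_const.mul (continuous_arctan.comp_continuousOn
        (ContinuousOn.div (by fun_prop) (by fun_prop) fun t ht => ?_)))
  · have := sqrt_nonneg (1 - C t ^ 2 - E t ^ 2)
    have := h t ht
    nlinarith [sq_nonneg (E t)]
  · have hm := sqrt_nonneg (1 - C t ^ 2 - E t ^ 2)
    have hm' := sqrt_nonneg (1 - a ^ 2 - b ^ 2)
    have hα := sin_sq_add_cos_sq (d t)
    have hp := h t ht
    have hsq : (a * cos (d t) + b * sin (d t)) ^ 2 + (b * cos (d t) - a * sin (d t)) ^ 2
        = a ^ 2 + b ^ 2 := by linear_combination (a ^ 2 + b ^ 2) * hα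
    have h1 := sq_nonneg (C t - (a * cos (d t) + b * sin (d t)))
    have h2 := sq_nonneg (E t - (b * cos (d t) - a * sin (d t)))
    have h3 := mul_nonneg hm hm'
    refine ne_of_gt ?_
    linarith

theorem kleinTurning_two_pi {a b e : ℝ} (hab : a ^ 2 + b ^ 2 < 1) (he : a ^ 2 + e ^ 2 < 1) :
    kleinTurning a b (2 * π) a e = 2 * π + kleinTurning a b 0 a b := by
  have hconv : Convex ℝ {x : ℝ | a ^ 2 + x ^ 2 < 1} := by
    have h := (even_two.convexOn_pow (𝕜 := ℝ)).convex_lt (1 - a ^ 2)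
    have hset : {x : ℝ | x ∈ univ ∧ x ^ 2 < 1 - a ^ 2} = {x | a ^ 2 + x ^ 2 < 1} := by
      ext x
      simp [lt_sub_iff_add_lt']
    rwa [hset] at h
  have hder : ∀ x ∈ {x : ℝ | a ^ 2 + x ^ 2 < 1},
      HasDerivWithinAt (fun u => kleinTurning a b 0 a u) 0 {x : ℝ | a ^ 2 + x ^ 2 < 1} x := by
    intro x hx
    obtain ⟨W, -, hW⟩ := hasDerivAt_kleinTurning (d := fun _ => 0) (C := fun _ => a)
      (E := fun u => u) (t := x) (G := 1) (hasDerivAt_const x (0 : ℝ))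
      ((hasDerivAt_const x a).congr_deriv (by simp)) ((hasDerivAt_id x).congr_deriv (by simp))
      hx hab
    exact (hW.congr_deriv (by simp)).hasDerivWithinAt
  have hconst := hconv.norm_image_sub_le_of_norm_hasDerivWithin_le (C := 0) hder (by simp) hab he
  rw [zero_mul, norm_le_zero_iff, sub_eq_zero] at hconst
  rw [← hconst]
  simp [kleinTurning]
  ring

theorem strictMonoOn_of_hasDerivAt_pos_of_ne {f : ℝ → ℝ} {a b w : ℝ}
    (hf : ContinuousOn f (Icc a b))
    (h : ∀ x ∈ Ioo a b, x ≠ w → ∃ f' > 0, HasDerivAt f f' x) : StrictMonoOn f (Icc a b) := by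
  have key : ∀ a' b', a ≤ a' → b' ≤ b → w ∉ Ioo a' b' → StrictMonoOn f (Icc a' b') := by
    intro a' b' ha hb hw
    refine strictMonoOn_of_deriv_pos (convex_Icc _ _) (hf.mono (Icc_subset_Icc ha hb)) ?_
    rw [interior_Icc]
    intro x hx
    obtain ⟨f', hpos, hder⟩ := h x ⟨ha.trans_lt hx.1, hx.2.trans_le hb⟩ (fun e => hw (e ▸ hx))
    rwa [hder.deriv]
  by_cases hw : w ∈ Ioo a b
  · rw [← Icc_union_Icc_eq_Icc hw.1.le hw.2.le]
    exact (key a w le_rfl hw.2.le (by simp)).union (key w b hw.1.le le_rfl (by simp))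
      (isGreatest_Icc hw.1.le) (isLeast_Icc hw.2.le)
  · exact key a b le_rfl le_rfl hw

/-- A solution `C` of `C'' + C = F` with `F > 0`, closed up after `2π` by a convex corner, stays
above the solution of the homogeneous equation tangent to it at the corner. -/
theorem tangent_lt_of_convex_of_closed {C E F : ℝ → ℝ} {y w : ℝ}
    (hC : ContinuousOn C (Icc y (y + 2 * π))) (hE : ContinuousOn E (Icc y (y + 2 * π)))
    (hder : ∀ s ∈ Ioo y (y + 2 * π), s ≠ w →
      HasDerivAt C (E s) s ∧ HasDerivAt E (F s - C s) s ∧ 0 < F s)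
    (hCy : C (y + 2 * π) = C y) (hEy : E (y + 2 * π) ≤ E y) {u : ℝ}
    (hu : u ∈ Ioo y (y + 2 * π)) :
    C y * cos (u - y) + E y * sin (u - y) < C u := by
  have hφ : ∀ s ∈ Ioo y (y + 2 * π), s ≠ w →
      HasDerivAt (fun s => E s * sin (u - s) + C s * cos (u - s)) (F s * sin (u - s)) s := by
    intro s hs hw
    obtain ⟨h1, h2, -⟩ := hder s hs hw
    have h3 := (hasDerivAt_id s).const_sub u
    exact ((h2.mul h3.sin).add (h1.mul h3.cos)).congr_deriv (by simp; ring)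
  have hcont : ContinuousOn (fun s => E s * sin (u - s) + C s * cos (u - s))
    (Icc y (y + 2 * π)) := by fun_prop
  rcases le_total u (y + π) with h | h
  · have hmono : StrictMonoOn (fun s => E s * sin (u - s) + C s * cos (u - s)) (Icc y u) := by
      refine strictMonoOn_of_hasDerivAt_pos_of_ne (w := w)
        (hcont.mono (Icc_subset_Icc le_rfl hu.2.le)) fun s hs hw => ?_
      have hs' : s ∈ Ioo y (y + 2 * π) := ⟨hs.1, hs.2.trans hu.2⟩
      exact ⟨_, mul_pos (hder s hs' hw).2.2 (sin_pos_of_pos_of_lt_pi (by linarith [hs.2])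
        (by linarith [hs.1])), hφ s hs' hw⟩
    have := hmono (left_mem_Icc.2 hu.1.le) (right_mem_Icc.2 hu.1.le) hu.1
    simp at this
    linarith
  · have hmono : StrictMonoOn (fun s => -(E s * sin (u - s) + C s * cos (u - s)))
        (Icc u (y + 2 * π)) := by
      refine strictMonoOn_of_hasDerivAt_pos_of_ne (w := w)
        (hcont.mono (Icc_subset_Icc hu.1.le le_rfl)).neg fun s hs hw => ?_
      have hs' : s ∈ Ioo y (y + 2 * π) := ⟨hu.1.trans hs.1, hs.2⟩
      exact ⟨_, by nlinarith [mul_pos (hder s hs' hw).2.2 (neg_pos.2 (sin_neg_of_neg_of_neg_pi_lt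
        (by linarith [hs.1] : u - s < 0) (by linarith [hs.2])))], (hφ s hs' hw).neg⟩
    have := hmono (left_mem_Icc.2 hu.2.le) (right_mem_Icc.2 hu.2.le) hu.2
    simp only [sub_self, sin_zero, cos_zero, ← sub_sub, sin_sub_two_pi, cos_sub_two_pi, hCy] at this
    have hsin : sin (u - y) ≤ 0 := by
      rw [← sin_sub_two_pi]
      exact sin_nonpos_of_nonpos_of_neg_pi_le (by linarith [hu.2]) (by linarith)
    nlinarith [mul_nonneg (sub_nonneg.2 hEy) (neg_nonneg.2 hsin)]

/-- Length of the space-like curve `(cos s, sin s, C s) / √(1 - C s ^ 2)` of the de Sitter sphere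
per unit of `s`, where `E` is the derivative of `C`. -/
noncomputable def canalSpeed (C E : ℝ) : ℝ := √(1 - C ^ 2 - E ^ 2) / (1 - C ^ 2)

theorem ContinuousOn.canalSpeed {C E : ℝ → ℝ} {s : Set ℝ} (hC : ContinuousOn C s)
    (hE : ContinuousOn E s) (h : ∀ t ∈ s, C t ^ 2 + E t ^ 2 < 1) :
    ContinuousOn (fun t => canalSpeed (C t) (E t)) s :=
  ContinuousOn.div (by fun_prop) (by fun_prop) fun t ht => by
    have := h t ht
    nlinarith [sq_nonneg (E t)]

theorem canalSpeed_nonneg {C E : ℝ} (h : C ^ 2 + E ^ 2 < 1) : 0 ≤ canalSpeed C E :=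
  div_nonneg (sqrt_nonneg _) (by nlinarith [sq_nonneg E])

theorem two_pi_lt_length_of_convex_of_closed {C E F : ℝ → ℝ} {y w : ℝ}
    (hC : ContinuousOn C (Icc y (y + 2 * π))) (hE : ContinuousOn E (Icc y (y + 2 * π)))
    (hder : ∀ s ∈ Ioo y (y + 2 * π), s ≠ w →
      HasDerivAt C (E s) s ∧ HasDerivAt E (F s - C s) s ∧ 0 < F s)
    (hlt : ∀ s ∈ Icc y (y + 2 * π), C s ^ 2 + E s ^ 2 < 1)
    (hCy : C (y + 2 * π) = C y) (hEy : E (y + 2 * π) ≤ E y) :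
    2 * π < ∫ s in y..y + 2 * π, canalSpeed (C s) (E s) := by
  have hle : y < y + 2 * π := by linarith [pi_pos]
  have hy := hlt y (left_mem_Icc.2 hle.le)
  have hv := hC.canalSpeed hE hlt
  have hint := hv.intervalIntegrable_of_Icc (μ := MeasureTheory.volume) hle.le
  have hmono : StrictMonoOn (fun u => (∫ s in y..u, canalSpeed (C s) (E s)) -
      kleinTurning (C y) (E y) (u - y) (C u) (E u)) (Icc y (y + 2 * π)) := by
    refine strictMonoOn_of_hasDerivAt_pos_of_ne (w := w) (ContinuousOn.sub ?_
      (continuousOn_kleinTurning (by fun_prop) hC hE hlt hy)) fun u hu hw => ?_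
    · have := intervalIntegral.continuousOn_primitive_interval (a := y) (b := y + 2 * π)
        (f := fun s => canalSpeed (C s) (E s)) (μ := MeasureTheory.volume)
      rw [uIcc_of_le hle.le] at this
      exact this (hv.integrableOn_Icc)
    · obtain ⟨h1, h2, h3⟩ := hder u hu hw
      have hu' := Ioo_subset_Icc_self hu
      obtain ⟨W, hW, hturn⟩ := hasDerivAt_kleinTurning (a := C y) (b := E y) (G := F u)
        ((hasDerivAt_id u).sub_const y) (h1.congr_deriv (by simp)) (h2.congr_deriv (by simp))
        (hlt u hu') hy
      have hint' := intervalIntegral.integral_hasDerivAt_right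
        (hint.mono_set (by
          rw [uIcc_of_le hu.1.le, uIcc_of_le hle.le]; exact Icc_subset_Icc le_rfl hu.2.le))
        ((hv.mono Ioo_subset_Icc_self).stronglyMeasurableAtFilter isOpen_Ioo u hu)
        (hv.continuousAt (Icc_mem_nhds hu.1 hu.2))
      refine ⟨_, ?_, hint'.sub hturn⟩
      have hg := tangent_lt_of_convex_of_closed hC hE hder hCy hEy hu
      have := mul_pos (mul_pos h3 (sub_pos.2 hg)) hW
      simpa [canalSpeed] using this
  have := hmono (left_mem_Icc.2 hle.le) (right_mem_Icc.2 hle.le) hle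
  have hend := kleinTurning_two_pi hy (hCy ▸ hlt _ (right_mem_Icc.2 hle.le))
  simp only [intervalIntegral.integral_same, sub_self, add_sub_cancel_left, hCy, hend] at this
  linarith

theorem exists_chord_of_min_endpoints {C E : ℝ → ℝ} {x₀ x₁ h : ℝ}
    (hC : ContinuousOn C (Icc x₀ x₁)) (hder : ∀ s ∈ Ioo x₀ x₁, HasDerivAt C (E s) s)
    (hmin₀ : ∀ s ∈ Icc x₀ x₁, C x₀ ≤ C s) (hmin₁ : ∀ s ∈ Icc x₀ x₁, C x₁ ≤ C s)
    (hE₀ : E x₀ = 0) (hE₁ : E x₁ = 0) (h₀ : 0 ≤ h) (h₁ : h ≤ x₁ - x₀) :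
    ∃ s ∈ Icc x₀ (x₁ - h), C (s + h) = C s ∧ E (s + h) ≤ E s := by
  have hle : x₀ ≤ x₁ - h := by linarith
  have hx₀ : x₀ ∈ Icc x₀ x₁ := ⟨le_rfl, by linarith⟩
  have hx₁ : x₁ ∈ Icc x₀ x₁ := ⟨by linarith, le_rfl⟩
  have hends : C x₀ = C x₁ := le_antisymm (hmin₀ _ hx₁) (hmin₁ _ hx₀)
  have hzero : ∀ p ∈ Icc x₀ x₁, C p = C x₀ → E p = 0 := by
    intro p hp hCp
    rcases eq_endpoints_or_mem_Ioo_of_mem_Icc hp with rfl | rfl | hp'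
    · exact hE₀
    · exact hE₁
    · refine IsLocalMin.hasDerivAt_eq_zero ?_ (hder p hp')
      filter_upwards [Icc_mem_nhds hp'.1 hp'.2] with q hq
      exact hCp ▸ hmin₀ q hq
  have hshift : ∀ s ∈ Icc x₀ (x₁ - h), s ∈ Icc x₀ x₁ ∧ s + h ∈ Icc x₀ x₁ := fun s hs =>
    ⟨⟨hs.1, by linarith [hs.2]⟩, ⟨by linarith [hs.1], by linarith [hs.2]⟩⟩
  have hcont : ContinuousOn (fun s => C (s + h) - C s) (Icc x₀ (x₁ - h)) :=
    (hC.comp (by fun_prop) fun s hs => (hshift s hs).2).sub (hC.mono fun s hs => (hshift s hs).1)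
  obtain ⟨s, ⟨hs, hds⟩, hleast⟩ := (isCompact_Icc.of_isClosed_subset
    (hcont.preimage_isClosed_of_isClosed isClosed_Icc isClosed_Iic) inter_subset_left
    : IsCompact (Icc x₀ (x₁ - h) ∩ (fun s => C (s + h) - C s) ⁻¹' Iic 0)).exists_isLeast
    ⟨x₁ - h, right_mem_Icc.2 hle, by simpa using hmin₁ _ (hshift _ (right_mem_Icc.2 hle)).1⟩
  have hds : C (s + h) - C s ≤ 0 := hds
  refine ⟨s, hs, ?_⟩
  rcases hs.1.eq_or_lt with rfl | hlt
  · have heq : C (x₀ + h) = C x₀ := le_antisymm (by linarith) (hmin₀ _ (hshift _ hs).2)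
    exact ⟨heq, by rw [hzero _ (hshift _ hs).2 heq, hE₀]⟩
  have hbefore : ∀ u ∈ Ico x₀ s, 0 < C (u + h) - C u := fun u hu => by
    by_contra! hu'
    exact absurd (hleast ⟨⟨hu.1, hu.2.le.trans hs.2⟩, hu'⟩) (not_le.2 hu.2)
  have heq : C (s + h) - C s = 0 := by
    refine hds.antisymm (not_lt.1 fun hneg => ?_)
    obtain ⟨u, hu, hu0⟩ := intermediate_value_Icc' hs.1 (hcont.mono (Icc_subset_Icc le_rfl hs.2))
      ⟨hneg.le, (hbefore x₀ ⟨le_rfl, hlt⟩).le⟩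
    have hu0 : C (u + h) - C u = 0 := hu0
    rcases hu.2.eq_or_lt with rfl | hu'
    · exact hneg.ne hu0
    · exact (hbefore u ⟨hu.1, hu'⟩).ne' hu0
  refine ⟨sub_eq_zero.1 heq, ?_⟩
  rcases hs.2.eq_or_lt with rfl | hlt'
  · rw [sub_add_cancel] at heq ⊢
    rw [hE₁, hzero _ (hshift _ hs).1 (by linarith)]
  · have hd := (HasDerivAt.comp_add_const s h (hder (s + h) ⟨by linarith, by linarith⟩)).sub
      (hder s ⟨hlt, by linarith⟩)
    have hslope := (hasDerivWithinAt_iff_tendsto_slope' self_notMem_Iio).1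
      (hd.hasDerivWithinAt (s := Iio s))
    refine sub_nonpos.1 (le_of_tendsto hslope ?_)
    filter_upwards [Ico_mem_nhdsLT hlt] with u hu
    rw [slope_def_field]
    exact div_nonpos_of_nonneg_of_nonpos (by simpa [heq] using (hbefore u hu).le)
      (by linarith [hu.2])

/-- The function equal to `f` up to `x₁` and to `f` translated by `l` afterwards. -/
noncomputable def glueShift (f : ℝ → ℝ) (x₁ l : ℝ) (u : ℝ) : ℝ := if u ≤ x₁ then f u else f (u - l)

theorem glueShift_of_le {f : ℝ → ℝ} {x₁ l u : ℝ} (h : u ≤ x₁) : glueShift f x₁ l u = f u := if_pos h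

theorem glueShift_of_lt {f : ℝ → ℝ} {x₁ l u : ℝ} (h : x₁ < u) :
    glueShift f x₁ l u = f (u - l) := if_neg h.not_ge

theorem glueShift_of_ge {f : ℝ → ℝ} {x₀ x₁ u : ℝ} (hf : f x₁ = f x₀) (h : x₁ ≤ u) :
    glueShift f x₁ (x₁ - x₀) u = f (u - (x₁ - x₀)) := by
  rcases h.eq_or_lt with rfl | h
  · rw [glueShift_of_le le_rfl, sub_sub_cancel, hf]
  · exact glueShift_of_lt h

theorem continuousOn_glueShift {f : ℝ → ℝ} {x₀ x₁ a b : ℝ} (hf : ContinuousOn f (Icc x₀ x₁))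
    (hends : f x₁ = f x₀) (ha : x₀ ≤ a) (hb : b ≤ x₁ + (x₁ - x₀)) :
    ContinuousOn (glueShift f x₁ (x₁ - x₀)) (Icc a b) := by
  have h₁ : ContinuousOn (glueShift f x₁ (x₁ - x₀)) (Icc x₀ x₁) :=
    hf.congr fun u hu => glueShift_of_le hu.2
  have h₂ : ContinuousOn (glueShift f x₁ (x₁ - x₀)) (Icc x₁ (x₁ + (x₁ - x₀))) :=
    (hf.comp (by fun_prop : ContinuousOn (fun u => u - (x₁ - x₀)) _)
      fun u hu => ⟨by linarith [hu.1], by linarith [hu.2]⟩).congr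
        fun u hu => glueShift_of_ge hends hu.1
  refine (h₁.union_of_isClosed h₂ isClosed_Icc isClosed_Icc).mono fun u hu => ?_
  rcases le_total u x₁ with h | h
  · exact Or.inl ⟨ha.trans hu.1, h⟩
  · exact Or.inr ⟨h, hu.2.trans hb⟩

theorem hasDerivAt_glueShift {f : ℝ → ℝ} {x₁ l u f' : ℝ}
    (h : u < x₁ ∧ HasDerivAt f f' u ∨ x₁ < u ∧ HasDerivAt f f' (u - l)) :
    HasDerivAt (glueShift f x₁ l) f' u := by
  rcases h with ⟨hu, hf⟩ | ⟨hu, hf⟩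
  · refine hf.congr_of_eventuallyEq ?_
    filter_upwards [Iio_mem_nhds hu] with v hv using glueShift_of_le (le_of_lt hv)
  · refine (HasDerivAt.comp_sub_const u l hf).congr_of_eventuallyEq ?_
    filter_upwards [Ioi_mem_nhds hu] with v hv using glueShift_of_lt hv

theorem two_pi_lt_length_of_min_endpoints {C E F : ℝ → ℝ} {x₀ x₁ : ℝ}
    (hC : ContinuousOn C (Icc x₀ x₁)) (hE : ContinuousOn E (Icc x₀ x₁))
    (hder : ∀ s ∈ Ioo x₀ x₁, HasDerivAt C (E s) s ∧ HasDerivAt E (F s - C s) s ∧ 0 < F s)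
    (hlt : ∀ s ∈ Icc x₀ x₁, C s ^ 2 + E s ^ 2 < 1) (hlen : 2 * π ≤ x₁ - x₀)
    (hE₀ : E x₀ = 0) (hE₁ : E x₁ = 0)
    (hmin : ∀ s ∈ Icc x₀ x₁, C x₀ ≤ C s ∧ C x₁ ≤ C s) :
    2 * π < ∫ s in x₀..x₁, canalSpeed (C s) (E s) := by
  have hπ := pi_pos
  obtain ⟨s, hs, hCs, hEs⟩ := exists_chord_of_min_endpoints hC (fun s hs => (hder s hs).1)
    (fun s hs => (hmin s hs).1) (fun s hs => (hmin s hs).2) hE₀ hE₁ (by positivity) hlen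
  have hsub : Icc s (s + 2 * π) ⊆ Icc x₀ x₁ := Icc_subset_Icc hs.1 (by linarith [hs.2])
  refine (two_pi_lt_length_of_convex_of_closed (w := s) (hC.mono hsub) (hE.mono hsub)
    (fun u hu _ => hder u (Ioo_subset_Ioo hs.1 (by linarith [hs.2]) hu))
    (fun u hu => hlt u (hsub hu)) hCs hEs).trans_le ?_
  refine intervalIntegral.integral_mono_interval hs.1 (by linarith) (by linarith [hs.2])
    ?_ ((hC.canalSpeed hE hlt).intervalIntegrable_of_Icc (by linarith))
  filter_upwards [MeasureTheory.ae_restrict_mem measurableSet_Ioc] with u hu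
  exact canalSpeed_nonneg (hlt u (Ioc_subset_Icc_self hu))

theorem two_pi_lt_length_of_max_endpoints {C E F : ℝ → ℝ} {x₀ x₁ : ℝ}
    (hC : ContinuousOn C (Icc x₀ x₁)) (hE : ContinuousOn E (Icc x₀ x₁))
    (hder : ∀ s ∈ Ioo x₀ x₁, HasDerivAt C (E s) s ∧ HasDerivAt E (F s - C s) s ∧ 0 < F s)
    (hlt : ∀ s ∈ Icc x₀ x₁, C s ^ 2 + E s ^ 2 < 1) (hlen : 2 * π ≤ x₁ - x₀)
    (hE₀ : E x₀ = 0) (hE₁ : E x₁ = 0)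
    (hmax : ∀ s ∈ Icc x₀ x₁, C s ≤ C x₀ ∧ C s ≤ C x₁) :
    2 * π < ∫ s in x₀..x₁, canalSpeed (C s) (E s) := by
  have hπ := pi_pos
  have hle : x₀ ≤ x₁ := by linarith
  obtain ⟨s, hs, hCs, hEs⟩ := exists_chord_of_min_endpoints (h := x₁ - x₀ - 2 * π) hC.neg
    (fun s hs => (hder s hs).1.neg) (fun s hs => neg_le_neg (hmax s hs).1)
    (fun s hs => neg_le_neg (hmax s hs).2) (by simpa using hE₀) (by simpa using hE₁)
    (by linarith) (by linarith)
  simp only [Pi.neg_apply, neg_inj, neg_le_neg_iff] at hCs hEs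
  have hends : C x₁ = C x₀ :=
    le_antisymm (hmax x₁ (right_mem_Icc.2 hle)).1 (hmax x₀ (left_mem_Icc.2 hle)).2
  have hEends : E x₁ = E x₀ := hE₁.trans hE₀.symm
  have hs₁ := hs.1
  have hs₂ := hs.2
  have hv := hC.canalSpeed hE hlt
  generalize hy : s + (x₁ - x₀ - 2 * π) = y at hCs hEs
  have hend : y + 2 * π - (x₁ - x₀) = s := by linarith
  have hx₁y : x₁ ≤ y + 2 * π := by linarith
  have hglt : ∀ u ∈ Icc y (y + 2 * π),
      glueShift C x₁ (x₁ - x₀) u ^ 2 + glueShift E x₁ (x₁ - x₀) u ^ 2 < 1 := fun u hu => by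
    rcases le_total u x₁ with h | h
    · simp only [glueShift_of_le h]
      exact hlt u ⟨by linarith [hu.1], h⟩
    · rw [glueShift_of_ge hends h, glueShift_of_ge hEends h]
      exact hlt _ ⟨by linarith, by linarith [hu.2]⟩
  have key := two_pi_lt_length_of_convex_of_closed (C := glueShift C x₁ (x₁ - x₀))
    (E := glueShift E x₁ (x₁ - x₀)) (F := glueShift F x₁ (x₁ - x₀)) (y := y) (w := x₁)
    (continuousOn_glueShift hC hends (by linarith) (by linarith))
    (continuousOn_glueShift hE hEends (by linarith) (by linarith))
    (fun u hu hne => by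
      rcases hne.lt_or_gt with h | h
      · obtain ⟨h1, h2, h3⟩ := hder u ⟨by linarith [hu.1], h⟩
        simp only [glueShift_of_le h.le]
        exact ⟨hasDerivAt_glueShift (.inl ⟨h, h1⟩), hasDerivAt_glueShift (.inl ⟨h, h2⟩), h3⟩
      · obtain ⟨h1, h2, h3⟩ := hder (u - (x₁ - x₀)) ⟨by linarith, by linarith [hu.2]⟩
        simp only [glueShift_of_lt h]
        exact ⟨hasDerivAt_glueShift (.inr ⟨h, h1⟩), hasDerivAt_glueShift (.inr ⟨h, h2⟩), h3⟩)
    hglt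
    (by rw [glueShift_of_ge hends hx₁y, hend, glueShift_of_le (by linarith), hCs])
    (by rw [glueShift_of_ge hEends hx₁y, hend, glueShift_of_le (by linarith)]; exact hEs)
  have hyx₁ : y ≤ x₁ := by linarith
  have hxy : x₀ ≤ y := by linarith
  have hleft : ∫ u in y..x₁, canalSpeed (glueShift C x₁ (x₁ - x₀) u) (glueShift E x₁ (x₁ - x₀) u)
      = ∫ u in y..x₁, canalSpeed (C u) (E u) := by
    refine intervalIntegral.integral_congr fun u hu => ?_
    rw [uIcc_of_le hyx₁] at hu
    simp only [glueShift_of_le hu.2]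
  have hright : ∫ u in x₁..y + 2 * π,
      canalSpeed (glueShift C x₁ (x₁ - x₀) u) (glueShift E x₁ (x₁ - x₀) u)
      = ∫ u in x₀..s, canalSpeed (C u) (E u) := by
    have := intervalIntegral.integral_comp_sub_right (a := x₁) (b := y + 2 * π)
      (fun u => canalSpeed (C u) (E u)) (x₁ - x₀)
    rw [hend, sub_sub_cancel] at this
    rw [← this]
    refine intervalIntegral.integral_congr fun u hu => ?_
    rw [uIcc_of_le hx₁y] at hu
    simp only [glueShift_of_ge hends hu.1, glueShift_of_ge hEends hu.1]
  have hI : ∀ a b, x₀ ≤ a → a ≤ b → b ≤ x₁ →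
      IntervalIntegrable (fun u => canalSpeed (C u) (E u)) MeasureTheory.volume a b :=
    fun a b ha hab hb => (hv.mono (Icc_subset_Icc ha hb)).intervalIntegrable_of_Icc hab
  have hmid : 0 ≤ ∫ u in s..y, canalSpeed (C u) (E u) :=
    intervalIntegral.integral_nonneg (by linarith) fun u hu =>
      canalSpeed_nonneg (hlt u ⟨hs₁.trans hu.1, hu.2.trans hyx₁⟩)
  have hg : ContinuousOn (fun u => canalSpeed (glueShift C x₁ (x₁ - x₀) u)
      (glueShift E x₁ (x₁ - x₀) u)) (Icc y (y + 2 * π)) :=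
    ContinuousOn.canalSpeed (continuousOn_glueShift hC hends hxy (by linarith))
      (continuousOn_glueShift hE hEends hxy (by linarith)) hglt
  rw [← intervalIntegral.integral_add_adjacent_intervals
    ((hg.mono (Icc_subset_Icc le_rfl hx₁y)).intervalIntegrable_of_Icc hyx₁)
    ((hg.mono (Icc_subset_Icc hyx₁ le_rfl)).intervalIntegrable_of_Icc hx₁y), hleft, hright] at key
  have h1 := intervalIntegral.integral_add_adjacent_intervals
    (hI x₀ s le_rfl hs₁ (by linarith)) (hI s y hs₁ (by linarith) hyx₁)
  have h2 := intervalIntegral.integral_add_adjacent_intervals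
    (hI x₀ y le_rfl hxy hyx₁) (hI y x₁ hxy hyx₁ le_rfl)
  linarith

theorem two_pi_lt_length_of_endpoints {C E F : ℝ → ℝ} {x₀ x₁ : ℝ}
    (hC : ContinuousOn C (Icc x₀ x₁)) (hE : ContinuousOn E (Icc x₀ x₁))
    (hder : ∀ s ∈ Ioo x₀ x₁, HasDerivAt C (E s) s ∧ HasDerivAt E (F s - C s) s ∧ 0 < F s)
    (hlt : ∀ s ∈ Icc x₀ x₁, C s ^ 2 + E s ^ 2 < 1) (hlen : 2 * π ≤ x₁ - x₀)
    (hE₀ : E x₀ = 0) (hE₁ : E x₁ = 0)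
    (hext : (∀ s ∈ Icc x₀ x₁, C x₀ ≤ C s ∧ C x₁ ≤ C s) ∨
      ∀ s ∈ Icc x₀ x₁, C s ≤ C x₀ ∧ C s ≤ C x₁) :
    2 * π < ∫ s in x₀..x₁, canalSpeed (C s) (E s) :=
  hext.elim (two_pi_lt_length_of_min_endpoints hC hE hder hlt hlen hE₀ hE₁)
    (two_pi_lt_length_of_max_endpoints hC hE hder hlt hlen hE₀ hE₁)

theorem continuousOn_of_compact_leftInverse {f g : ℝ → ℝ} {s t : Set ℝ} (hs : IsCompact s)
    (hf : ContinuousOn f s) (hg : MapsTo g t s) (hgf : LeftInvOn g f s) (hfg : LeftInvOn f g t) :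
    ContinuousOn g t := by
  refine continuousOn_iff_isClosed.2 fun k hk =>
    ⟨f '' (s ∩ k), ((hs.inter_right hk).image_of_continuousOn
      (hf.mono inter_subset_left)).isClosed, ?_⟩
  ext y
  constructor
  · rintro ⟨hyk, hyt⟩
    exact ⟨⟨g y, ⟨hg hyt, hyk⟩, hfg hyt⟩, hyt⟩
  · rintro ⟨⟨x, ⟨hxs, hxk⟩, rfl⟩, hyt⟩
    exact ⟨by simpa [hgf hxs] using hxk, hyt⟩

theorem two_pi_lt_length_of_graph_of_pos {θ θ₁ θ₂ c c₁ c₂ : ℝ → ℝ} {a b : ℝ} (hab : a ≤ b)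
    (hθ : ∀ t ∈ Icc a b, HasDerivAt θ (θ₁ t) t) (hθ₁ : ∀ t ∈ Icc a b, HasDerivAt θ₁ (θ₂ t) t)
    (hc : ∀ t ∈ Icc a b, HasDerivAt c (c₁ t) t) (hc₁ : ∀ t ∈ Icc a b, HasDerivAt c₁ (c₂ t) t)
    (hpos : ∀ t ∈ Icc a b, 0 < θ₁ t)
    (hconv : ∀ t ∈ Icc a b, 0 < θ₁ t * c₂ t - c₁ t * θ₂ t + c t * θ₁ t ^ 3)
    (hlt : ∀ t ∈ Icc a b, c t ^ 2 + (c₁ t / θ₁ t) ^ 2 < 1)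
    (hlen : 2 * π ≤ ∫ t in a..b, θ₁ t) (hca : c₁ a = 0) (hcb : c₁ b = 0)
    (hext : (∀ t ∈ Icc a b, c a ≤ c t ∧ c b ≤ c t) ∨ ∀ t ∈ Icc a b, c t ≤ c a ∧ c t ≤ c b) :
    2 * π < ∫ t in a..b, canalSpeed (c t) (c₁ t / θ₁ t) * θ₁ t := by
  have ha := left_mem_Icc.2 hab
  have hb := right_mem_Icc.2 hab
  have hcontθ : ContinuousOn θ (Icc a b) := fun t ht => (hθ t ht).continuousAt.continuousWithinAt
  have hcontθ₁ : ContinuousOn θ₁ (Icc a b) :=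
    fun t ht => (hθ₁ t ht).continuousAt.continuousWithinAt
  have hcontc : ContinuousOn c (Icc a b) := fun t ht => (hc t ht).continuousAt.continuousWithinAt
  have hcontc₁ : ContinuousOn c₁ (Icc a b) :=
    fun t ht => (hc₁ t ht).continuousAt.continuousWithinAt
  have hcontE : ContinuousOn (fun t => c₁ t / θ₁ t) (Icc a b) :=
    hcontc₁.div hcontθ₁ fun t ht => (hpos t ht).ne'
  have hftc : ∫ t in a..b, θ₁ t = θ b - θ a :=
    intervalIntegral.integral_eq_sub_of_hasDerivAt (by rwa [uIcc_of_le hab])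
      (hcontθ₁.intervalIntegrable_of_Icc hab)
  have hmono : StrictMonoOn θ (Icc a b) := strictMonoOn_of_hasDerivAt_pos_of_ne (w := a) hcontθ
    fun t ht _ => ⟨_, hpos t (Ioo_subset_Icc_self ht), hθ t (Ioo_subset_Icc_self ht)⟩
  have hsurj : SurjOn θ (Icc a b) (Icc (θ a) (θ b)) := intermediate_value_Icc hab hcontθ
  set T := Function.invFunOn θ (Icc a b)
  have hTθ : LeftInvOn T θ (Icc a b) := hmono.injOn.leftInvOn_invFunOn
  have hθT : LeftInvOn θ T (Icc (θ a) (θ b)) := hsurj.rightInvOn_invFunOn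
  have hmaps : MapsTo T (Icc (θ a) (θ b)) (Icc a b) := hsurj.mapsTo_invFunOn
  have hTa : T (θ a) = a := hTθ ha
  have hTb : T (θ b) = b := hTθ hb
  have hcontT : ContinuousOn T (Icc (θ a) (θ b)) :=
    continuousOn_of_compact_leftInverse isCompact_Icc hcontθ hmaps hTθ hθT
  have hderT : ∀ s ∈ Ioo (θ a) (θ b), HasDerivAt T (θ₁ (T s))⁻¹ s := fun s hs => by
    have hnhds := Icc_mem_nhds hs.1 hs.2
    have hTs := hmaps (Ioo_subset_Icc_self hs)
    exact HasDerivAt.of_local_left_inverse (hcontT.continuousAt hnhds) (hθ _ hTs) (hpos _ hTs).ne'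
      (Filter.mem_of_superset hnhds fun y hy => hθT hy)
  have key := two_pi_lt_length_of_endpoints (x₀ := θ a) (x₁ := θ b) (C := fun s => c (T s))
    (E := fun s => c₁ (T s) / θ₁ (T s))
    (F := fun s => (θ₁ (T s) * c₂ (T s) - c₁ (T s) * θ₂ (T s) + c (T s) * θ₁ (T s) ^ 3) /
      θ₁ (T s) ^ 3)
    (hcontc.comp hcontT hmaps) (hcontE.comp hcontT hmaps)
    (fun s hs => by
      have hTs := hmaps (Ioo_subset_Icc_self hs)
      have hp := hpos _ hTs
      refine ⟨(hc _ hTs).comp s (hderT s hs), ?_, div_pos (hconv _ hTs) (by positivity)⟩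
      refine (((hc₁ _ hTs).div (hθ₁ _ hTs) hp.ne').comp s (hderT s hs)).congr_deriv ?_
      field_simp
      ring)
    (fun s hs => hlt _ (hmaps hs)) (by rwa [← hftc]) (by simp [hTa, hca]) (by simp [hTb, hcb])
    (by
      simp only [hTa, hTb]
      exact hext.imp (fun h s hs => h _ (hmaps hs)) fun h s hs => h _ (hmaps hs))
  rw [← intervalIntegral.integral_comp_mul_deriv_of_deriv_nonneg (f := θ) (f' := θ₁)
    (by rwa [uIcc_of_le hab])
    (fun t ht => hθ t (by
      rw [min_eq_left hab, max_eq_right hab] at ht; exact Ioo_subset_Icc_self ht))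
    (fun t ht => (hpos t
      (by rw [min_eq_left hab, max_eq_right hab] at ht; exact Ioo_subset_Icc_self ht)).le)] at key
  refine key.trans_eq (intervalIntegral.integral_congr fun t ht => ?_)
  rw [uIcc_of_le hab] at ht
  simp only [Function.comp_apply, hTθ ht]

theorem pos_or_neg_of_continuousOn_of_ne_zero {f : ℝ → ℝ} {a b : ℝ} (hf : ContinuousOn f (Icc a b))
    (hne : ∀ t ∈ Icc a b, f t ≠ 0) : (∀ t ∈ Icc a b, 0 < f t) ∨ ∀ t ∈ Icc a b, f t < 0 := by
  by_contra! ⟨⟨x, hx, hfx⟩, y, hy, hfy⟩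
  obtain ⟨z, hz, hfz⟩ := isPreconnected_Icc.intermediate_value hx hy hf ⟨hfx, hfy⟩
  exact hne z hz hfz

theorem two_pi_lt_length_of_graph {θ θ₁ θ₂ c c₁ c₂ : ℝ → ℝ} {a b : ℝ} (hab : a ≤ b)
    (hθ : ∀ t ∈ Icc a b, HasDerivAt θ (θ₁ t) t) (hθ₁ : ∀ t ∈ Icc a b, HasDerivAt θ₁ (θ₂ t) t)
    (hc : ∀ t ∈ Icc a b, HasDerivAt c (c₁ t) t) (hc₁ : ∀ t ∈ Icc a b, HasDerivAt c₁ (c₂ t) t)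
    (hθ₂ : ContinuousOn θ₂ (Icc a b)) (hc₂ : ContinuousOn c₂ (Icc a b))
    (hne : ∀ t ∈ Icc a b, θ₁ t ≠ 0)
    (hconv : ∀ t ∈ Icc a b, θ₁ t * c₂ t - c₁ t * θ₂ t + c t * θ₁ t ^ 3 ≠ 0)
    (hlt : ∀ t ∈ Icc a b, c t ^ 2 + (c₁ t / θ₁ t) ^ 2 < 1)
    (hlen : 2 * π ≤ ∫ t in a..b, |θ₁ t|) (hca : c₁ a = 0) (hcb : c₁ b = 0)
    (hmax : ∀ t ∈ Icc a b, c t ≤ c a ∧ c t ≤ c b) :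
    2 * π < ∫ t in a..b, canalSpeed (c t) (c₁ t / θ₁ t) * |θ₁ t| := by
  have hcontθ₁ : ContinuousOn θ₁ (Icc a b) :=
    fun t ht => (hθ₁ t ht).continuousAt.continuousWithinAt
  have hcontc : ContinuousOn c (Icc a b) := fun t ht => (hc t ht).continuousAt.continuousWithinAt
  have hcontc₁ : ContinuousOn c₁ (Icc a b) :=
    fun t ht => (hc₁ t ht).continuousAt.continuousWithinAt
  have hcongr : ∀ {f g : ℝ → ℝ}, (∀ t ∈ Icc a b, f t = g t) → ∫ t in a..b, f t = ∫ t in a..b, g t :=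
    fun h => intervalIntegral.integral_congr fun t ht => h t (by rwa [uIcc_of_le hab] at ht)
  rcases pos_or_neg_of_continuousOn_of_ne_zero hcontθ₁ hne with hs | hs <;>
  rcases pos_or_neg_of_continuousOn_of_ne_zero (by fun_prop) hconv with hk | hk
  · rw [hcongr fun t ht => abs_of_pos (hs t ht)] at hlen
    refine (two_pi_lt_length_of_graph_of_pos hab hθ hθ₁ hc hc₁ hs hk hlt hlen hca hcb
      (.inr hmax)).trans_eq (hcongr fun t ht => ?_)
    rw [abs_of_pos (hs t ht)]
  · rw [hcongr fun t ht => abs_of_pos (hs t ht)] at hlen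
    refine (two_pi_lt_length_of_graph_of_pos hab hθ hθ₁ (fun t ht => (hc t ht).neg)
      (fun t ht => (hc₁ t ht).neg) hs (fun t ht => by simp only [Pi.neg_apply]; linarith [hk t ht])
      (fun t ht => by simpa [neg_div] using hlt t ht) hlen (by simpa) (by simpa)
      (.inl fun t ht => by simpa using hmax t ht)).trans_eq (hcongr fun t ht => ?_)
    rw [abs_of_pos (hs t ht)]
    simp [canalSpeed, neg_div]
  · rw [hcongr fun t ht => abs_of_neg (hs t ht)] at hlen
    refine (two_pi_lt_length_of_graph_of_pos hab (fun t ht => (hθ t ht).neg)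
      (fun t ht => (hθ₁ t ht).neg) (fun t ht => (hc t ht).neg)
      (fun t ht => (hc₁ t ht).neg) (fun t ht => by linarith [hs t ht])
      (fun t ht => by simp only [Pi.neg_apply]; linarith [hk t ht])
      (fun t ht => by simpa using hlt t ht) hlen (by simpa) (by simpa)
      (.inl fun t ht => by simpa using hmax t ht)).trans_eq (hcongr fun t ht => ?_)
    rw [abs_of_neg (hs t ht)]
    simp [canalSpeed]
  · rw [hcongr fun t ht => abs_of_neg (hs t ht)] at hlen
    refine (two_pi_lt_length_of_graph_of_pos hab (fun t ht => (hθ t ht).neg)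
      (fun t ht => (hθ₁ t ht).neg) hc hc₁ (fun t ht => by linarith [hs t ht])
      (fun t ht => by linarith [hk t ht])
      (fun t ht => by simpa [div_neg] using hlt t ht) hlen hca hcb
      (.inr hmax)).trans_eq (hcongr fun t ht => ?_)
    rw [abs_of_neg (hs t ht)]
    simp [canalSpeed, div_neg]

theorem HasDerivAt.lorentz3 {f g : ℝ → Fin 3 → ℝ} {f' g' : Fin 3 → ℝ} {t : ℝ}
    (hf : HasDerivAt f f' t) (hg : HasDerivAt g g' t) :
    HasDerivAt (fun u => lorentz3 (f u) (g u)) (lorentz3 f' (g t) + lorentz3 (f t) g') t := by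
  rw [hasDerivAt_pi] at hf hg
  unfold _root_.lorentz3
  exact ((((hf 0).mul (hg 0)).add ((hf 1).mul (hg 1))).sub ((hf 2).mul (hg 2))).congr_deriv
    (by ring)

theorem lorentz3_comm (x y : Fin 3 → ℝ) : lorentz3 x y = lorentz3 y x := by
  unfold lorentz3
  ring

theorem lorentz3_deriv_of_unit {f f₁ f₂ : ℝ → Fin 3 → ℝ} {U : Set ℝ} (hU : IsOpen U)
    (hf : ∀ t ∈ U, HasDerivAt f (f₁ t) t) (hf₁ : ∀ t ∈ U, HasDerivAt f₁ (f₂ t) t)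
    (hunit : ∀ t ∈ U, lorentz3 (f t) (f t) = 1) {t : ℝ} (ht : t ∈ U) :
    lorentz3 (f t) (f₁ t) = 0 ∧ lorentz3 (f t) (f₂ t) = -lorentz3 (f₁ t) (f₁ t) := by
  have hconst : ∀ {φ : ℝ → ℝ} {φ' k : ℝ}, ∀ s ∈ U, HasDerivAt φ φ' s → (∀ u ∈ U, φ u = k) →
      φ' = 0 := fun s hs hφ hk => hφ.unique <|
    (hasDerivAt_const s _).congr_of_eventuallyEq (Filter.mem_of_superset (hU.mem_nhds hs) hk)
  have horth : ∀ s ∈ U, lorentz3 (f s) (f₁ s) = 0 := fun s hs => by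
    have := hconst s hs ((hf s hs).lorentz3 (hf s hs)) hunit
    rw [lorentz3_comm (f₁ s)] at this
    linarith
  have := hconst t ht ((hf t ht).lorentz3 (hf₁ t ht)) horth
  exact ⟨horth t ht, by linarith⟩

theorem det_sq_eq_neg_lorentz3_gram (u v w : Fin 3 → ℝ) :
    (Matrix.of ![u, v, w]).det ^ 2 = -(Matrix.of
      ![![lorentz3 u u, lorentz3 u v, lorentz3 u w], ![lorentz3 u v, lorentz3 v v, lorentz3 v w],
        ![lorentz3 u w, lorentz3 v w, lorentz3 w w]]).det := by
  simp [Matrix.det_fin_three, lorentz3]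
  ring

/-- The triple `(u, v, w)` of the position, the velocity and the acceleration of a space-like curve
in the de Sitter sphere is a basis when the geodesic curvature vector is time-like. -/
theorem det_ne_zero_of_curvature_timelike {u v w : Fin 3 → ℝ} (hu : lorentz3 u u = 1)
    (huv : lorentz3 u v = 0) (huw : lorentz3 u w = -lorentz3 v v) (hv : 0 < lorentz3 v v)
    (hk : lorentz3 (u + (lorentz3 v v)⁻¹ • (w - (lorentz3 w v / lorentz3 v v) • v))
      (u + (lorentz3 v v)⁻¹ • (w - (lorentz3 w v / lorentz3 v v) • v)) < 0) :
    (Matrix.of ![u, v, w]).det ≠ 0 := by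
  intro hdet
  generalize hQ : lorentz3 v v = Q at *
  generalize hP : lorentz3 w v = P at *
  set k := u + Q⁻¹ • (w - (P / Q) • v) with hkdef
  have hk₀ : lorentz3 u k = 0 := by
    have : lorentz3 u k = lorentz3 u u + Q⁻¹ * (lorentz3 u w - P / Q * lorentz3 u v) := by
      simp [hkdef, lorentz3]
      ring
    rw [this, hu, huw, huv]
    field_simp
    ring
  have hk₁ : lorentz3 v k = 0 := by
    have : lorentz3 v k = lorentz3 u v + Q⁻¹ * (lorentz3 w v - P / Q * lorentz3 v v) := by
      simp [hkdef, lorentz3]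
      ring
    rw [this, hP, hQ, huv]
    field_simp
    ring
  have hdetk : (Matrix.of ![u, v, k]).det = Q⁻¹ * (Matrix.of ![u, v, w]).det := by
    simp [hkdef, Matrix.det_fin_three]
    ring
  have hgram := det_sq_eq_neg_lorentz3_gram u v k
  rw [hdetk, hdet, hk₀, hk₁, hu, huv, hQ] at hgram
  simp [Matrix.det_fin_three] at hgram
  rcases hgram with h | h
  · exact hv.ne' h
  · exact hk.ne h

theorem hasDerivAt_vec_three {f g h : ℝ → ℝ} {f' g' h' t : ℝ} (hf : HasDerivAt f f' t)
    (hg : HasDerivAt g g' t) (hh : HasDerivAt h h' t) :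
    HasDerivAt (fun u => ![f u, g u, h u]) ![f', g', h'] t := by
  rw [hasDerivAt_pi]
  intro i
  fin_cases i
  exacts [hf, hg, hh]

/-- The vector `ρ • (cos θ, sin θ, c)`. -/
noncomputable def canalVec (θ ρ c : ℝ) : Fin 3 → ℝ := ![cos θ * ρ, sin θ * ρ, c * ρ]

/-- The velocity of `canalVec θ ρ c` when `θ`, `ρ`, `c` move with velocities `θ₁`, `ρ₁`, `c₁`. -/
noncomputable def canalVel (θ ρ c θ₁ ρ₁ c₁ : ℝ) : Fin 3 → ℝ :=
  ![cos θ * ρ₁ - sin θ * θ₁ * ρ, sin θ * ρ₁ + cos θ * θ₁ * ρ, c * ρ₁ + c₁ * ρ]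

/-- The acceleration of `canalVec θ ρ c` when `θ`, `ρ`, `c` move with velocities `θ₁`, `ρ₁`, `c₁`
and accelerations `θ₂`, `ρ₂`, `c₂`. -/
noncomputable def canalAcc (θ ρ c θ₁ ρ₁ c₁ θ₂ ρ₂ c₂ : ℝ) : Fin 3 → ℝ :=
  ![cos θ * ρ₂ - 2 * sin θ * θ₁ * ρ₁ - (cos θ * θ₁ ^ 2 + sin θ * θ₂) * ρ,
    sin θ * ρ₂ + 2 * cos θ * θ₁ * ρ₁ + (cos θ * θ₂ - sin θ * θ₁ ^ 2) * ρ,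
    c * ρ₂ + 2 * c₁ * ρ₁ + c₂ * ρ]

section

variable {θ ρ c θ₁ ρ₁ c₁ : ℝ → ℝ} {θ₂ ρ₂ c₂ t : ℝ}

theorem hasDerivAt_canalVec (hθ : HasDerivAt θ (θ₁ t) t) (hρ : HasDerivAt ρ (ρ₁ t) t)
    (hc : HasDerivAt c (c₁ t) t) :
    HasDerivAt (fun u => canalVec (θ u) (ρ u) (c u))
      (canalVel (θ t) (ρ t) (c t) (θ₁ t) (ρ₁ t) (c₁ t)) t :=
  hasDerivAt_vec_three ((hθ.cos.mul hρ).congr_deriv (by ring))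
    ((hθ.sin.mul hρ).congr_deriv (by ring)) ((hc.mul hρ).congr_deriv (by ring))

theorem hasDerivAt_canalVel (hθ : HasDerivAt θ (θ₁ t) t) (hρ : HasDerivAt ρ (ρ₁ t) t)
    (hc : HasDerivAt c (c₁ t) t) (hθ₁ : HasDerivAt θ₁ θ₂ t) (hρ₁ : HasDerivAt ρ₁ ρ₂ t)
    (hc₁ : HasDerivAt c₁ c₂ t) :
    HasDerivAt (fun u => canalVel (θ u) (ρ u) (c u) (θ₁ u) (ρ₁ u) (c₁ u))
      (canalAcc (θ t) (ρ t) (c t) (θ₁ t) (ρ₁ t) (c₁ t) θ₂ ρ₂ c₂) t :=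
  hasDerivAt_vec_three
    (((hθ.cos.mul hρ₁).sub ((hθ.sin.mul hθ₁).mul hρ)).congr_deriv (by simp; ring))
    (((hθ.sin.mul hρ₁).add ((hθ.cos.mul hθ₁).mul hρ)).congr_deriv (by simp; ring))
    (((hc.mul hρ₁).add (hc₁.mul hρ)).congr_deriv (by ring))

end

theorem det_canal_frame (θ ρ c θ₁ ρ₁ c₁ θ₂ ρ₂ c₂ : ℝ) :
    (Matrix.of ![canalVec θ ρ c, canalVel θ ρ c θ₁ ρ₁ c₁, canalAcc θ ρ c θ₁ ρ₁ c₁ θ₂ ρ₂ c₂]).det =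
      ρ ^ 3 * (θ₁ * c₂ - c₁ * θ₂ + c * θ₁ ^ 3) := by
  have h := sin_sq_add_cos_sq θ
  simp [Matrix.det_fin_three, canalVec, canalVel, canalAcc]
  grind

theorem lorentz3_canalVec {θ r : ℝ} (hr : sin r ≠ 0) :
    lorentz3 (canalVec θ (sin r)⁻¹ (cos r)) (canalVec θ (sin r)⁻¹ (cos r)) = 1 := by
  have h1 := sin_sq_add_cos_sq θ
  have h2 := sin_sq_add_cos_sq r
  simp [lorentz3, canalVec]
  field_simp
  grind

theorem lorentz3_canalVel {θ r θ₁ r₁ : ℝ} (hr : sin r ≠ 0) :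
    lorentz3 (canalVel θ (sin r)⁻¹ (cos r) θ₁ (-(cos r * r₁) / sin r ^ 2) (-sin r * r₁))
      (canalVel θ (sin r)⁻¹ (cos r) θ₁ (-(cos r * r₁) / sin r ^ 2) (-sin r * r₁)) =
      (θ₁ ^ 2 - r₁ ^ 2) / sin r ^ 2 := by
  have h1 := sin_sq_add_cos_sq θ
  have h2 := sin_sq_add_cos_sq r
  simp [lorentz3, canalVel]
  field_simp
  grind

theorem canalSpeed_mul_abs {r θ₁ r₁ : ℝ} (hr : sin r ≠ 0) (hlt : r₁ ^ 2 < θ₁ ^ 2) :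
    cos r ^ 2 + (-sin r * r₁ / θ₁) ^ 2 < 1 ∧
      √((θ₁ ^ 2 - r₁ ^ 2) / sin r ^ 2) = canalSpeed (cos r) (-sin r * r₁ / θ₁) * |θ₁| := by
  have hθ₁ : θ₁ ≠ 0 := by
    rintro rfl
    nlinarith [sq_nonneg r₁]
  have hθ₁' := sq_pos_of_ne_zero hθ₁
  have hr' := sq_pos_of_ne_zero hr
  have heq : 1 - cos r ^ 2 - (-sin r * r₁ / θ₁) ^ 2
      = sin r ^ 2 * (θ₁ ^ 2 - r₁ ^ 2) / θ₁ ^ 2 := by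
    have h := sin_sq_add_cos_sq r
    field_simp
    grind
  have hpos : 0 < 1 - cos r ^ 2 - (-sin r * r₁ / θ₁) ^ 2 := by
    rw [heq]
    exact div_pos (mul_pos hr' (sub_pos.2 hlt)) hθ₁'
  have hlt' : cos r ^ 2 + (-sin r * r₁ / θ₁) ^ 2 < 1 := by linarith
  refine ⟨hlt', ?_⟩
  rw [sqrt_eq_iff_eq_sq (div_nonneg (sub_pos.2 hlt).le hr'.le)
    (mul_nonneg (canalSpeed_nonneg hlt') (abs_nonneg _)), canalSpeed, mul_pow, div_pow,
    sq_sqrt hpos.le, heq, sq_abs, ← sin_sq]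
  field_simp

/-- A regular canal of 0-spheres in S¹ whose curve of centers has length at
least `2π`, and whose radius is minimal at both endpoints with vanishing
derivative there, has Lorentz length strictly greater than `2π`. -/
theorem length_of_regular_canal_in_S1
    (θ r : ℝ → ℝ) (hθ : ContDiff ℝ (⊤ : ℕ∞) θ) (hr : ContDiff ℝ (⊤ : ℕ∞) r)
    (hr_range : ∀ t ∈ Set.Icc (0:ℝ) 1, 0 < r t ∧ r t < Real.pi)
    (σ : ℝ → Fin 3 → ℝ)
    (hσdef : σ = fun t => ![Real.cos (θ t) / Real.sin (r t),
                            Real.sin (θ t) / Real.sin (r t),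
                            Real.cos (r t) / Real.sin (r t)])
    -- (i) the path is space-like
    (hspace : ∀ t ∈ Set.Icc (0:ℝ) 1, 0 < lorentz3 (deriv σ t) (deriv σ t))
    -- the geodesic curvature vector
    (kg : ℝ → Fin 3 → ℝ)
    (hkgdef : ∀ t, kg t = σ t +
      (lorentz3 (deriv σ t) (deriv σ t))⁻¹ •
        (deriv (deriv σ) t -
          (lorentz3 (deriv (deriv σ) t) (deriv σ t) /
            lorentz3 (deriv σ t) (deriv σ t)) • deriv σ t))
    -- (ii) the canal is regular
    (hreg : ∀ t ∈ Set.Icc (0:ℝ) 1, lorentz3 (kg t) (kg t) < 0)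
    -- (iii) the curve of centers has length at least 2π
    (hcenters : 2 * Real.pi ≤ ∫ t in (0:ℝ)..1, |deriv θ t|)
    -- (iv) r is minimal at both endpoints, with vanishing derivative
    (hmin0 : ∀ t ∈ Set.Icc (0:ℝ) 1, r 0 ≤ r t)
    (hmin1 : ∀ t ∈ Set.Icc (0:ℝ) 1, r 1 ≤ r t)
    (hr'0 : deriv r 0 = 0) (hr'1 : deriv r 1 = 0) :
    2 * Real.pi < ∫ t in (0:ℝ)..1, Real.sqrt (lorentz3 (deriv σ t) (deriv σ t)) := by

  have hsin : ∀ t ∈ Icc (0 : ℝ) 1, sin (r t) ≠ 0 := fun t ht =>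
    (sin_pos_of_pos_of_lt_pi (hr_range t ht).1 (hr_range t ht).2).ne'
  set θ₁ := deriv θ
  set r₁ := deriv r
  have smooth : ∀ {f : ℝ → ℝ}, ContDiff ℝ (⊤ : ℕ∞) f → ContDiff ℝ (⊤ : ℕ∞) (deriv f) ∧
      ∀ t, HasDerivAt f (deriv f t) t := fun hf =>
    ⟨(contDiff_infty_iff_deriv.1 hf).2, fun t => (contDiff_infty_iff_deriv.1 hf).1 t |>.hasDerivAt⟩
  obtain ⟨hθ₁, hθd⟩ := smooth hθ
  obtain ⟨hθ₂, hθ₁d⟩ := smooth hθ₁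
  obtain ⟨hr₁, hrd⟩ := smooth hr
  obtain ⟨hr₂, hr₁d⟩ := smooth hr₁
  set U := {t | sin (r t) ≠ 0}
  have hU : IsOpen U := isOpen_ne_fun (continuous_sin.comp hr.continuous) continuous_const
  have hc : ∀ t, HasDerivAt (fun t => cos (r t)) (-sin (r t) * r₁ t) t := fun t => (hrd t).cos
  have hc₁ : ∀ t, HasDerivAt (fun t => -sin (r t) * r₁ t)
      (-cos (r t) * r₁ t ^ 2 - sin (r t) * deriv r₁ t) t := fun t =>
    ((hrd t).sin.neg.mul (hr₁d t)).congr_deriv (by simp; ring)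
  have hρ : ∀ t ∈ U, HasDerivAt (fun t => (sin (r t))⁻¹) (-(cos (r t) * r₁ t) / sin (r t) ^ 2) t :=
    fun t ht => (hrd t).sin.inv ht
  have hρ₁ : ∀ t ∈ U, ∃ ρ₂, HasDerivAt (fun t => -(cos (r t) * r₁ t) / sin (r t) ^ 2) ρ₂ t :=
    fun t ht => ⟨_, ((hc t).mul (hr₁d t)).neg.div ((hrd t).sin.pow 2) (pow_ne_zero 2 ht)⟩
  choose! ρ₂ hρ₁ using hρ₁
  have hσ : ∀ t ∈ U, HasDerivAt σ (canalVel (θ t) (sin (r t))⁻¹ (cos (r t)) (θ₁ t)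
      (-(cos (r t) * r₁ t) / sin (r t) ^ 2) (-sin (r t) * r₁ t)) t := fun t ht => by
    rw [hσdef]
    exact hasDerivAt_canalVec (θ₁ := θ₁) (ρ₁ := fun t => -(cos (r t) * r₁ t) / sin (r t) ^ 2)
      (c₁ := fun t => -sin (r t) * r₁ t) (hθd t) (hρ t ht) (hc t)
  have hderiv : ∀ t ∈ U, deriv σ =ᶠ[nhds t] fun t => canalVel (θ t) (sin (r t))⁻¹ (cos (r t)) (θ₁ t)
      (-(cos (r t) * r₁ t) / sin (r t) ^ 2) (-sin (r t) * r₁ t) := fun t ht =>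
    Filter.mem_of_superset (hU.mem_nhds ht) fun s hs => (hσ s hs).deriv
  have hσ₁ : ∀ t ∈ U, HasDerivAt (deriv σ) _ t := fun t ht =>
    (hasDerivAt_canalVel (hθd t) (hρ t ht) (hc t) (hθ₁d t) (hρ₁ t ht) (hc₁ t)).congr_of_eventuallyEq
      (hderiv t ht)
  have hunit : ∀ t ∈ U, lorentz3 (σ t) (σ t) = 1 := fun t ht => by
    rw [hσdef]
    exact lorentz3_canalVec ht
  have hQ : ∀ t ∈ U, lorentz3 (deriv σ t) (deriv σ t) = (θ₁ t ^ 2 - r₁ t ^ 2) / sin (r t) ^ 2 :=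
    fun t ht => by
      rw [(hσ t ht).deriv]
      exact lorentz3_canalVel ht
  have hlt : ∀ t ∈ Icc (0 : ℝ) 1, r₁ t ^ 2 < θ₁ t ^ 2 := fun t ht => by
    have h := hspace t ht
    rw [hQ t (hsin t ht), div_pos_iff_of_pos_right (sq_pos_of_ne_zero (hsin t ht))] at h
    linarith
  have hconv : ∀ t ∈ Icc (0 : ℝ) 1, θ₁ t * (-cos (r t) * r₁ t ^ 2 - sin (r t) * deriv r₁ t) -
      -sin (r t) * r₁ t * deriv θ₁ t + cos (r t) * θ₁ t ^ 3 ≠ 0 := fun t ht h => by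
    have ht' := hsin t ht
    obtain ⟨horth, hacc⟩ := lorentz3_deriv_of_unit hU
      (fun s hs => (hσ s hs).differentiableAt.hasDerivAt)
      (fun s hs => (hσ₁ s hs).differentiableAt.hasDerivAt) hunit ht'
    have hk := hreg t ht
    rw [hkgdef] at hk
    refine det_ne_zero_of_curvature_timelike (hunit t ht') horth hacc (hspace t ht) hk ?_
    rw [(hσ₁ t ht').deriv, (hσ t ht').deriv, hσdef]
    exact (det_canal_frame ..).trans (by rw [h, mul_zero])
  have key := two_pi_lt_length_of_graph zero_le_one (fun t _ => hθd t) (fun t _ => hθ₁d t)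
    (fun t _ => hc t) (fun t _ => hc₁ t) hθ₂.continuous.continuousOn
    (by
      have := hr.continuous
      have := hr₁.continuous
      have := hr₂.continuous
      fun_prop)
    (fun t ht h0 => by nlinarith [hlt t ht, sq_nonneg (r₁ t)])
    hconv (fun t ht => (canalSpeed_mul_abs (hsin t ht) (hlt t ht)).1) hcenters (by simp [hr'0])
    (by simp [hr'1]) (fun t ht => by
      have := hr_range t ht
      exact ⟨cos_le_cos_of_nonneg_of_le_pi (hr_range 0 (by simp)).1.le this.2.le (hmin0 t ht),
        cos_le_cos_of_nonneg_of_le_pi (hr_range 1 (by simp)).1.le this.2.le (hmin1 t ht)⟩)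
  refine key.trans_eq (intervalIntegral.integral_congr fun t ht => ?_)
  rw [uIcc_of_le zero_le_one] at ht
  simp only [hQ t (hsin t ht)]
  exact (canalSpeed_mul_abs (hsin t ht) (hlt t ht)).2.symm
end
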